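/- arXiv:2110.14078 — 2 statements merged into one kernel-verified Lean document; each statement's English description precedes it below -/
import Mathlib

section
/- Let N ≥ 2 be an integer, M an integer with 1 ≤ M < N, and η ∈ (0,1) a real. Let w : {1,...,N} → ℝ be strictly positive, set W = ∑ᵢ wᵢ and θ = (1/M − η/N)/(1−η). If max_j w_j ≥ θ·W, then there exists κ with 0 < κ ≤ max_j w_j satisfying κ = θ·( κ·|{i : wᵢ ≥ κ}| + ∑_{i : wᵢ < κ} wᵢ ). -/
/-- Capping the weights at `κ` splits the sum into the capped and the uncapped part. -/
lemma sum_min_eq_mul_card_add_sum_filter {ι : Type*} [Fintype ι] (w : ι → ℝ) (κ : ℝ) :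
    ∑ i, min κ (w i) = κ * ((Finset.univ.filter (fun i => κ ≤ w i)).card : ℝ)
      + ∑ i ∈ Finset.univ.filter (fun i => w i < κ), w i := by
  rw [← Finset.sum_filter_add_sum_filter_not Finset.univ (fun i => κ ≤ w i)]
  congr 1
  · rw [Finset.sum_congr rfl fun i hi => min_eq_left (Finset.mem_filter.1 hi).2,
      Finset.sum_const, nsmul_eq_mul, mul_comm]
  · simp only [not_le]
    exact Finset.sum_congr rfl fun i hi => min_eq_right (Finset.mem_filter.1 hi).2.le

open Finset

/-- Existence of the capping threshold `κ` in the Exp3.M-VP algorithm whenever the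
capping condition `max_j w_j ≥ θ·W` is triggered, where `θ = (1/M − η/N)/(1−η)`. -/
theorem exp3MVP_capping_threshold_exists
    (N M : ℕ) (hN : 2 ≤ N) (hM1 : 1 ≤ M) (hMN : M < N)
    (η : ℝ) (hη0 : 0 < η) (hη1 : η < 1)
    (w : Fin N → ℝ) (hw : ∀ i, 0 < w i)
    (W : ℝ) (hW : W = ∑ i, w i)
    (θ : ℝ) (hθ : θ = (1 / (M : ℝ) - η / N) / (1 - η))
    (maxw : ℝ) (hmaxw : IsGreatest (Set.range w) maxw)
    (htrigger : θ * W ≤ maxw) :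
    ∃ κ : ℝ, 0 < κ ∧ κ ≤ maxw ∧
      κ = θ * (κ * ((Finset.univ.filter (fun i : Fin N => κ ≤ w i)).card : ℝ)
        + ∑ i ∈ Finset.univ.filter (fun i : Fin N => w i < κ), w i) := by
  simp only [← sum_min_eq_mul_card_add_sum_filter]
  have hM : (0 : ℝ) < M := by exact_mod_cast hM1
  have hMN' : (M : ℝ) < N := by exact_mod_cast hMN
  have hθN : 1 ≤ θ * N := by
    have h : 1 ≤ (N : ℝ) / M := (one_le_div hM).2 hMN'.le
    have e : θ * N = ((N : ℝ) / M - η) / (1 - η) := by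
      have : (N : ℝ) ≠ 0 := (hM.trans hMN').ne'
      rw [hθ, div_mul_eq_mul_div, sub_mul, div_mul_cancel₀ _ this, one_div_mul_eq_div]
    rw [e, one_le_div (sub_pos.2 hη1)]
    linarith
  have : Nonempty (Fin N) := ⟨⟨0, by omega⟩⟩
  obtain ⟨j, hj⟩ := Finite.exists_min w
  have hle : ∀ i, w i ≤ maxw := fun i => hmaxw.2 ⟨i, rfl⟩
  have hcont : Continuous fun κ : ℝ => κ - θ * ∑ i, min κ (w i) := by fun_prop
  have hlow : w j - θ * ∑ i, min (w j) (w i) ≤ 0 := by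
    simp only [min_eq_left (hj _), sum_const, card_univ, Fintype.card_fin, nsmul_eq_mul]
    nlinarith [hw j]
  have hhigh : 0 ≤ maxw - θ * ∑ i, min maxw (w i) := by
    simp only [min_eq_right (hle _), ← hW]
    linarith
  obtain ⟨κ, hκ, h0⟩ := intermediate_value_Icc (hle j) hcont.continuousOn ⟨hlow, hhigh⟩
  exact ⟨κ, (hw j).trans_le hκ.1, hκ.2, sub_eq_zero.1 h0⟩
end

section
/- Let N be an integer with N ≥ 2, let μ₁ > μ₂ > ... > μ_N > 0 be strictly decreasing reals, and let a be an integer with 1 ≤ a < N. For a probability vector d = (d₁,...,d_N) (d_k ≥ 0, ∑_k d_k = 1) define F_a(d) = ∑_{k=1}^N μ_k d_k − max_{J ⊆ {1,...,N}, |J| = a} ∑_{j∈J} μ_j d_j, and for 1 ≤ K ≤ N set H_K = ∑_{k=1}^K 1/μ_k. Then the maximum of F_a over all probability vectors equals max over integers K with a ≤ K ≤ N of (K − a)/H_K. -/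
open Finset

/-- The reward fraction captured by the defender's best fixed set of `a` scanned
locations, against attack frequency vector `d` and location rewards `μ`. -/
noncomputable def defenderBest (N a : ℕ) (μ d : Fin N → ℝ) : ℝ :=
  sSup {x : ℝ | ∃ J : Finset (Fin N), J.card = a ∧ x = ∑ j ∈ J, μ j * d j}

/-- The attacker's worst-case average reward margin `F_a(d)`. -/
noncomputable def attackerMargin (N a : ℕ) (μ d : Fin N → ℝ) : ℝ :=
  (∑ k, μ k * d k) - defenderBest N a μ d

/-- `d` is a probability vector over the `N` locations. -/
def IsProbVec (N : ℕ) (d : Fin N → ℝ) : Prop :=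
  (∀ k, 0 ≤ d k) ∧ ∑ k, d k = 1

/-- `H_K = ∑_{k=1}^K 1/μ_k`. -/
noncomputable def Hsum (N : ℕ) (μ : Fin N → ℝ) (K : ℕ) : ℝ :=
  ∑ k ∈ Finset.univ.filter (fun k : Fin N => (k : ℕ) < K), 1 / μ k

/-- A set of `a` indices carrying the largest values of `y`, with a separating threshold. -/
theorem exists_top_finset {ι : Type*} [Fintype ι] [DecidableEq ι] (y : ι → ℝ) (a : ℕ)
    (ha : 1 ≤ a) (haN : a ≤ Fintype.card ι) :
    ∃ J : Finset ι, J.card = a ∧ ∃ i ∈ J, (∀ j ∈ J, y i ≤ y j) ∧ ∀ k ∉ J, y k ≤ y i := by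
  have hne : (powersetCard a (univ : Finset ι)).Nonempty :=
    powersetCard_nonempty.2 (by simpa using haN)
  obtain ⟨J, hJ, hmax⟩ := exists_max_image _ (fun J => ∑ j ∈ J, y j) hne
  have hcard : J.card = a := (mem_powersetCard.1 hJ).2
  obtain ⟨i, hi, hmin⟩ := exists_min_image J y (card_pos.1 (by omega))
  refine ⟨J, hcard, i, hi, hmin, fun k hk => ?_⟩
  have hk' : k ∉ J.erase i := fun h => hk (mem_of_mem_erase h)
  have h := hmax (insert k (J.erase i)) (mem_powersetCard.2 ⟨subset_univ _, by
    rw [card_insert_of_notMem hk', card_erase_of_mem hi]; omega⟩)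
  simp only [sum_insert hk'] at h
  have := add_sum_erase J y hi
  linarith

theorem sum_le_defenderBest {N a : ℕ} (μ d : Fin N → ℝ) (J : Finset (Fin N))
    (hJ : J.card = a) : ∑ j ∈ J, μ j * d j ≤ defenderBest N a μ d := by
  refine le_csSup (Set.Finite.bddAbove ?_) ⟨J, hJ, rfl⟩
  refine (Set.finite_range fun J : Finset (Fin N) => ∑ j ∈ J, μ j * d j).subset ?_
  rintro x ⟨J, -, rfl⟩
  exact ⟨J, rfl⟩

theorem card_filter_val_lt_of_le {N K : ℕ} (hK : K ≤ N) :
    (univ.filter fun k : Fin N => (k : ℕ) < K).card = K := by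
  simp [Fin.card_filter_val_lt, hK]

theorem Hsum_pos {N K : ℕ} {μ : Fin N → ℝ} (hμpos : ∀ k, 0 < μ k) (hK : 1 ≤ K)
    (hKN : K ≤ N) : 0 < Hsum N μ K := by
  refine sum_pos (fun k _ => one_div_pos.2 (hμpos k)) (card_pos.1 ?_)
  rw [card_filter_val_lt_of_le hKN]
  exact hK

theorem Hsum_nonneg {N : ℕ} {μ : Fin N → ℝ} (hμpos : ∀ k, 0 < μ k) (K : ℕ) :
    0 ≤ Hsum N μ K :=
  sum_nonneg fun k _ => (one_div_pos.2 (hμpos k)).le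

/-- For antitone rewards, the superlevel sets are initial segments. -/
theorem exists_lt_iff_val_lt {N : ℕ} {μ : Fin N → ℝ} (hμ : Antitone μ) (m : ℝ) :
    ∃ K ≤ N, ∀ k : Fin N, m < μ k ↔ (k : ℕ) < K := by
  classical
  have hex : ∃ K : ℕ, ∀ k : Fin N, K ≤ k → μ k ≤ m :=
    ⟨N, fun k hk => absurd k.isLt (not_lt.2 hk)⟩
  refine ⟨Nat.find hex, Nat.find_min' hex fun k hk => absurd k.isLt (not_lt.2 hk),
    fun k => ⟨fun h => ?_, fun h => ?_⟩⟩
  · by_contra! hk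
    exact absurd h (not_lt.2 (Nat.find_spec hex k hk))
  · by_contra! hk
    exact Nat.find_min hex h fun j hj => (hμ hj).trans hk

/-- The total positive part of `1 - m / μ k` is at most `a` once `m` bounds every ratio
`(K - a) / H_K`. -/
theorem sum_max_one_sub_div_le {N a : ℕ} {μ : Fin N → ℝ} (ha : 1 ≤ a)
    (hμpos : ∀ k, 0 < μ k) (hμ : Antitone μ) {m : ℝ} (hm0 : 0 ≤ m)
    (hm : ∀ K : ℕ, a ≤ K → K ≤ N → ((K : ℝ) - a) / Hsum N μ K ≤ m) :
    ∑ k, max (1 - m / μ k) 0 ≤ a := by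
  obtain ⟨K, hKN, hK⟩ := exists_lt_iff_val_lt hμ m
  have hsum : ∑ k, max (1 - m / μ k) 0 = K - m * Hsum N μ K := by
    have hterm : ∀ k : Fin N, max (1 - m / μ k) 0 =
        if (k : ℕ) < K then 1 - m * (1 / μ k) else 0 := by
      intro k
      split_ifs with h
      · have := (div_lt_one (hμpos k)).2 ((hK k).2 h)
        rw [max_eq_left (by linarith), mul_one_div]
      · have := (one_le_div (hμpos k)).2 (not_lt.1 (mt (hK k).1 h))
        exact max_eq_right (by linarith)
    rw [sum_congr rfl fun k _ => hterm k, ← sum_filter, sum_sub_distrib, ← mul_sum,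
      sum_const, card_filter_val_lt_of_le hKN, nsmul_eq_mul, mul_one, Hsum]
  rw [hsum]
  rcases le_or_gt a K with h | h
  · have := (div_le_iff₀ (Hsum_pos hμpos (ha.trans h) hKN)).1 (hm K h hKN)
    linarith
  · have h1 : (K : ℝ) ≤ a := by exact_mod_cast h.le
    have := mul_nonneg hm0 (Hsum_nonneg hμpos K)
    linarith

theorem attackerMargin_le {N a : ℕ} {μ d : Fin N → ℝ} (ha : 1 ≤ a) (haN : a ≤ N)
    (hμpos : ∀ k, 0 < μ k) (hμ : Antitone μ) {m : ℝ} (hm0 : 0 ≤ m)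
    (hm : ∀ K : ℕ, a ≤ K → K ≤ N → ((K : ℝ) - a) / Hsum N μ K ≤ m)
    (hd : IsProbVec N d) : attackerMargin N a μ d ≤ m := by
  obtain ⟨J, hJ, i, -, hge, hle⟩ :=
    exists_top_finset (fun k => μ k * d k) a ha (by simpa using haN)
  set t := μ i * d i
  have ht0 : 0 ≤ t := mul_nonneg (hμpos i).le (hd.1 i)
  have hbest := sum_le_defenderBest μ d J hJ
  have hpoint : ∀ k, μ k * d k - (if k ∈ J then μ k * d k else 0) - m * d k ≤
      t * max (1 - m / μ k) 0 - (if k ∈ J then t else 0) := by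
    intro k
    have hk := hμpos k
    have hmd : m * d k = m / μ k * (μ k * d k) := by field_simp
    have hq : 0 ≤ m / μ k := div_nonneg hm0 hk.le
    have hy : 0 ≤ μ k * d k := mul_nonneg hk.le (hd.1 k)
    rw [hmd]
    split_ifs with h
    · have h1 := mul_le_mul_of_nonneg_left (hge k h) hq
      have h2 := mul_le_mul_of_nonneg_left (le_max_left (1 - m / μ k) 0) ht0
      linarith
    · have h1 := mul_le_mul_of_nonneg_left (le_max_left (1 - m / μ k) 0) hy
      have h2 := mul_le_mul_of_nonneg_right (hle k h) (le_max_right (1 - m / μ k) 0)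
      linarith
  have hsum := sum_le_sum fun k (_ : k ∈ univ) => hpoint k
  simp only [sum_sub_distrib, ← mul_sum, sum_ite_mem, univ_inter, sum_const, hJ,
    nsmul_eq_mul, hd.2, mul_one] at hsum
  have hmax := mul_le_mul_of_nonneg_left (sum_max_one_sub_div_le ha hμpos hμ hm0 hm) ht0
  unfold attackerMargin
  linarith

/-- Attacking the first `K` locations with frequencies proportional to `1 / μ k` secures
`(K - a) / H_K`. -/
theorem exists_le_attackerMargin {N a K : ℕ} {μ : Fin N → ℝ} (ha : 1 ≤ a) (haK : a ≤ K)
    (hKN : K ≤ N) (hμpos : ∀ k, 0 < μ k) :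
    ∃ d, IsProbVec N d ∧ ((K : ℝ) - a) / Hsum N μ K ≤ attackerMargin N a μ d := by
  have hH := Hsum_pos hμpos (ha.trans haK) hKN
  let d : Fin N → ℝ := fun k => if (k : ℕ) < K then 1 / μ k / Hsum N μ K else 0
  have hmul : ∀ k, μ k * d k = if (k : ℕ) < K then 1 / Hsum N μ K else 0 := by
    intro k
    have := (hμpos k).ne'
    simp only [d]
    split_ifs
    · field_simp
    · simp
  refine ⟨d, ⟨fun k => ?_, ?_⟩, ?_⟩
  · have := hμpos k
    simp only [d]
    split_ifs <;> positivity
  · simp only [d]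
    rw [← sum_filter, ← sum_div]
    exact div_self hH.ne'
  · have hbest : defenderBest N a μ d ≤ a * (1 / Hsum N μ K) := by
      obtain ⟨J₀, -, hJ₀⟩ := exists_subset_card_eq
        (s := (univ : Finset (Fin N))) (n := a) (by simpa using haK.trans hKN)
      refine csSup_le ⟨_, J₀, hJ₀, rfl⟩ ?_
      rintro x ⟨J, hJ, rfl⟩
      rw [← hJ, ← nsmul_eq_mul]
      refine sum_le_card_nsmul _ _ _ fun k _ => ?_
      rw [hmul]
      split_ifs
      · exact le_rfl
      · positivity
    have htotal : ∑ k, μ k * d k = K * (1 / Hsum N μ K) := by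
      rw [sum_congr rfl fun k _ => hmul k, ← sum_filter, sum_const,
        card_filter_val_lt_of_le hKN, nsmul_eq_mul]
    rw [attackerMargin, htotal, div_eq_mul_one_div, sub_mul]
    linarith

/-- With strictly decreasing rewards, the maximum of `F_a` over probability vectors
equals the maximum of `(K − a)/H_K` over integers `a ≤ K ≤ N`. -/
theorem attacker_margin_max_value
    (N a : ℕ) (hN : 2 ≤ N) (ha1 : 1 ≤ a) (haN : a < N)
    (μ : Fin N → ℝ) (hμpos : ∀ k, 0 < μ k)
    (hμstrict : ∀ k j : Fin N, k < j → μ j < μ k) :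
    ∃ m : ℝ,
      IsGreatest {x : ℝ | ∃ d : Fin N → ℝ, IsProbVec N d ∧ x = attackerMargin N a μ d} m ∧
      IsGreatest {r : ℝ | ∃ K : ℕ, a ≤ K ∧ K ≤ N ∧ r = ((K : ℝ) - a) / Hsum N μ K} m := by
  have hμ : Antitone μ := StrictAnti.antitone fun k j h => hμstrict k j h
  obtain ⟨K, hK, hmax⟩ := exists_max_image (Icc a N)
    (fun K : ℕ => ((K : ℝ) - a) / Hsum N μ K) ⟨a, mem_Icc.2 ⟨le_rfl, haN.le⟩⟩
  obtain ⟨haK, hKN⟩ := mem_Icc.1 hK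
  have hm : ∀ L : ℕ, a ≤ L → L ≤ N →
      ((L : ℝ) - a) / Hsum N μ L ≤ ((K : ℝ) - a) / Hsum N μ K :=
    fun L h1 h2 => hmax L (mem_Icc.2 ⟨h1, h2⟩)
  have hm0 : 0 ≤ ((K : ℝ) - a) / Hsum N μ K := by
    simpa using hm a le_rfl haN.le
  obtain ⟨d, hd, hle⟩ := exists_le_attackerMargin ha1 haK hKN hμpos
  refine ⟨((K : ℝ) - a) / Hsum N μ K,
    ⟨⟨d, hd, hle.antisymm (attackerMargin_le ha1 haN.le hμpos hμ hm0 hm hd)⟩, ?_⟩,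
    ⟨⟨K, haK, hKN, rfl⟩, ?_⟩⟩
  · rintro x ⟨e, he, rfl⟩
    exact attackerMargin_le ha1 haN.le hμpos hμ hm0 hm he
  · rintro r ⟨L, h1, h2, rfl⟩
    exact hm L h1 h2
end
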